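/- For every positive integer u there exists a natural number N such that for every integer n ≥ N, the direct product Part(n)^u × Part(n+1)^u × … × Part(n+u−1)^u is a four-generated lattice. -/

import Mathlib

/-- A lattice is *four-generated* if it has a four-element subset `X` such that the
smallest sublattice containing `X` (the closure of `X` under binary meets and joins)
is the whole lattice. -/
def FourGenerated (L : Type*) [Lattice L] : Prop :=
  ∃ X : Finset L, X.card = 4 ∧ latticeClosure (X : Set L) = Set.univ

namespace Setoid

open Set

variable {X : Type*}

/-- The equivalence relation whose only possibly nontrivial class is `P`. -/
def block (P : Set X) : Setoid X where
  r x y := x = y ∨ (x ∈ P ∧ y ∈ P)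
  iseqv := by
    refine ⟨fun x => Or.inl rfl, fun h => ?_, fun h₁ h₂ => ?_⟩
    · rcases h with rfl | h
      · exact Or.inl rfl
      · exact Or.inr h.symm
    · rcases h₁ with rfl | h₁
      · exact h₂
      · rcases h₂ with rfl | h₂
        · exact Or.inr h₁
        · exact Or.inr ⟨h₁.1, h₂.2⟩

theorem block_iff {P : Set X} {x y : X} : block P x y ↔ x = y ∨ (x ∈ P ∧ y ∈ P) :=
  Iff.rfl

theorem block_mono {P Q : Set X} (h : P ⊆ Q) : block P ≤ block Q := by
  rintro x y (h' | h')
  · exact Or.inl h'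
  · exact Or.inr ⟨h h'.1, h h'.2⟩

theorem block_pair_rel (x y : X) : block {x, y} x y :=
  Or.inr ⟨Or.inl rfl, Or.inr rfl⟩

theorem block_pair_le {x y : X} {r : Setoid X} (h : r x y) : block {x, y} ≤ r := by
  rintro a b (rfl | ⟨rfl | rfl, rfl | rfl⟩)
  · exact r.refl' _
  · exact r.refl' _
  · exact h
  · exact r.symm' h
  · exact r.refl' _

theorem rel_sup_left {r s : Setoid X} {x y : X} (h : r x y) : (r ⊔ s) x y :=
  (le_sup_left : r ≤ r ⊔ s) h

theorem rel_sup_right {r s : Setoid X} {x y : X} (h : s x y) : (r ⊔ s) x y :=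
  (le_sup_right : s ≤ r ⊔ s) h

/-- A finite set of partitions that is closed under joins and contains all atoms is everything. -/
theorem eq_univ_of_block_pair_mem [Finite X] {T : Set (Setoid X)} (hsup : SupClosed T)
    (hbot : ⊥ ∈ T) (h : ∀ x y, x ≠ y → block {x, y} ∈ T) : T = univ := by
  refine eq_univ_of_forall fun r => ?_
  have key : r = ⨆ p : {p : X × X // p.1 ≠ p.2 ∧ r p.1 p.2}, block {p.1.1, p.1.2} := by
    apply le_antisymm
    · intro x y hxy
      by_cases hne : x = y
      · exact hne ▸ Setoid.refl' _ _
      · exact (le_iSup (fun p : {p : X × X // p.1 ≠ p.2 ∧ r p.1 p.2} => block {p.1.1, p.1.2})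
          ⟨(x, y), hne, hxy⟩) (block_pair_rel x y)
    · exact iSup_le fun p => block_pair_le p.2.2
  rw [key]
  exact hsup.iSup_mem hbot fun p => h _ _ p.2.1

/-- The edges of a Hamiltonian cycle generate the whole partition lattice. -/
theorem eq_univ_of_cycle_mem [Finite X] {T : Set (Setoid X)} (hT : IsSublattice T)
    (hbot : ⊥ ∈ T) (n : ℕ) (v : ℕ → X) (pos : X → ℕ) (hlt : ∀ x, pos x < n)
    (hv : ∀ x, v (pos x) = x) (hpos : ∀ k < n, pos (v k) = k)
    (hedge : ∀ k, k + 1 < n → block {v k, v (k + 1)} ∈ T)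
    (hlast : block {v (n - 1), v 0} ∈ T) : T = univ := by
  have seg : ∀ i d, i + d < n → ∃ s ∈ T, s (v i) (v (i + d)) ∧
      s ≤ block {z | i ≤ pos z ∧ pos z ≤ i + d} := by
    intro i d
    induction d with
    | zero => exact fun _ => ⟨⊥, hbot, Setoid.refl' _ _, bot_le⟩
    | succ d ih =>
      intro hd
      obtain ⟨s, hs, hr, hle⟩ := ih (by omega)
      refine ⟨s ⊔ block {v (i + d), v (i + d + 1)}, hT.supClosed hs (hedge _ (by omega)), ?_, ?_⟩
      · exact Setoid.trans' _ (rel_sup_left hr) (rel_sup_right (block_pair_rel _ _))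
      · refine sup_le (hle.trans (block_mono fun z hz => ?_)) (block_mono ?_)
        · simp only [mem_ofPred_eq] at hz ⊢
          omega
        · rintro z (rfl | rfl)
          · simp only [mem_ofPred_eq, hpos (i + d) (by omega)]
            omega
          · simp only [mem_ofPred_eq, hpos (i + d + 1) (by omega)]
            omega
  have main : ∀ i j, i < j → j < n → block {v i, v j} ∈ T := by
    intro i j hij hj
    obtain ⟨s, hs, hsr, hsle⟩ := seg i (j - i) (by omega)
    obtain ⟨t₁, ht₁, ht₁r, ht₁le⟩ := seg 0 i (by omega)
    obtain ⟨t₂, ht₂, ht₂r, ht₂le⟩ := seg j (n - 1 - j) (by omega)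
    rw [show i + (j - i) = j by omega] at hsr hsle
    rw [show j + (n - 1 - j) = n - 1 by omega] at ht₂r ht₂le
    rw [zero_add] at ht₁r ht₁le
    have : block {v i, v j} = s ⊓ ((t₁ ⊔ t₂) ⊔ block {v (n - 1), v 0}) := by
      apply le_antisymm
      · refine block_pair_le ⟨hsr, ?_⟩
        have h₁ := rel_sup_left (s := block {v (n - 1), v 0}) (rel_sup_left (s := t₂) ht₁r)
        have h₂ := rel_sup_left (s := block {v (n - 1), v 0}) (rel_sup_right (r := t₁) ht₂r)
        have h₃ := rel_sup_right (r := t₁ ⊔ t₂) (block_pair_rel (v (n - 1)) (v 0))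
        exact Setoid.symm' _ (Setoid.trans' _ h₂ (Setoid.trans' _ h₃ h₁))
      · have hle : (t₁ ⊔ t₂) ⊔ block {v (n - 1), v 0} ≤ block {z | pos z ≤ i ∨ j ≤ pos z} := by
          refine sup_le (sup_le (ht₁le.trans (block_mono ?_)) (ht₂le.trans (block_mono ?_)))
            (block_mono ?_)
          · exact fun z hz => Or.inl hz.2
          · exact fun z hz => Or.inr hz.1
          · rintro z (rfl | rfl)
            · simp only [mem_ofPred_eq, hpos (n - 1) (by omega)]
              omega
            · simp only [mem_ofPred_eq, hpos 0 (by omega)]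
              omega
        rintro x y ⟨h₁, h₂⟩
        rcases hsle h₁ with h₁ | h₁
        · exact Or.inl h₁
        rcases hle h₂ with h₂ | h₂
        · exact Or.inl h₂
        simp only [mem_ofPred_eq] at h₁ h₂
        have hmem : ∀ z, pos z = i ∨ pos z = j → z ∈ ({v i, v j} : Set X) := by
          rintro z (h | h)
          · exact Or.inl (by rw [← h, hv])
          · exact Or.inr (by rw [← h, hv]; rfl)
        exact Or.inr ⟨hmem x (by omega), hmem y (by omega)⟩
    rw [this]
    exact hT.infClosed hs (hT.supClosed (hT.supClosed ht₁ ht₂) hlast)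
  refine eq_univ_of_block_pair_mem hT.supClosed hbot fun x y hxy => ?_
  rcases lt_trichotomy (pos x) (pos y) with h | h | h
  · simpa [hv] using main _ _ h (hlt y)
  · exact absurd (by rw [← hv x, h, hv]) hxy
  · rw [pair_comm]
    simpa [hv] using main _ _ h (hlt x)

end Setoid

namespace PartConfig

section Terms

variable {M N : Type*} [Lattice M] [Lattice N]

/-- The term by which a partition contained in `a` grows by one unit in both directions. -/
def spread (a b c t : M) : M := ((t ⊔ b) ⊓ a) ⊔ ((t ⊔ c) ⊓ a)

/-- The partition obtained after `k` steps from the mark `b ⊓ d`. -/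
def fromLeft (a b c d : M) (k : ℕ) : M := (spread a b c)^[k] (a ⊓ ((b ⊓ d) ⊔ c))

/-- The partition obtained after `k` steps from the mark `c ⊓ d`. -/
def fromRight (a b c d : M) (k : ℕ) : M := (spread a b c)^[k] (a ⊓ ((c ⊓ d) ⊔ b))

/-- The term that turns a partition into the top element after `k` steps, if `k` is large and
the partition has a class with two elements at distance two. -/
def flood (a b c : M) (k : ℕ) (t : M) : M :=
  ((spread a b c)^[k] t ⊔ b) ⊓ ((spread a b c)^[k] t ⊔ c)

theorem iterate_spread_mem {S : Set M} (hS : IsSublattice S) {a b c t : M} (ha : a ∈ S)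
    (hb : b ∈ S) (hc : c ∈ S) (ht : t ∈ S) (k : ℕ) : (spread a b c)^[k] t ∈ S := by
  induction k with
  | zero => exact ht
  | succ k ih =>
    rw [Function.iterate_succ_apply']
    exact hS.supClosed (hS.infClosed (hS.supClosed ih hb) ha)
      (hS.infClosed (hS.supClosed ih hc) ha)

theorem fromLeft_mem {S : Set M} (hS : IsSublattice S) {a b c d : M} (ha : a ∈ S)
    (hb : b ∈ S) (hc : c ∈ S) (hd : d ∈ S) (k : ℕ) : fromLeft a b c d k ∈ S :=
  iterate_spread_mem hS ha hb hc
    (hS.infClosed ha (hS.supClosed (hS.infClosed hb hd) hc)) k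

theorem fromRight_mem {S : Set M} (hS : IsSublattice S) {a b c d : M} (ha : a ∈ S)
    (hb : b ∈ S) (hc : c ∈ S) (hd : d ∈ S) (k : ℕ) : fromRight a b c d k ∈ S :=
  iterate_spread_mem hS ha hb hc
    (hS.infClosed ha (hS.supClosed (hS.infClosed hc hd) hb)) k

theorem flood_mem {S : Set M} (hS : IsSublattice S) {a b c t : M} (ha : a ∈ S)
    (hb : b ∈ S) (hc : c ∈ S) (ht : t ∈ S) (k : ℕ) : flood a b c k t ∈ S :=
  have h := iterate_spread_mem hS ha hb hc ht k
  hS.infClosed (hS.supClosed h hb) (hS.supClosed h hc)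

theorem map_iterate_spread (f : LatticeHom M N) (a b c t : M) (k : ℕ) :
    f ((spread a b c)^[k] t) = (spread (f a) (f b) (f c))^[k] (f t) := by
  induction k with
  | zero => rfl
  | succ k ih =>
    simp only [Function.iterate_succ_apply', spread, map_sup, map_inf] at ih ⊢
    rw [ih]

theorem map_fromLeft (f : LatticeHom M N) (a b c d : M) (k : ℕ) :
    f (fromLeft a b c d k) = fromLeft (f a) (f b) (f c) (f d) k := by
  simp [fromLeft, map_iterate_spread]

theorem map_fromRight (f : LatticeHom M N) (a b c d : M) (k : ℕ) :
    f (fromRight a b c d k) = fromRight (f a) (f b) (f c) (f d) k := by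
  simp [fromRight, map_iterate_spread]

theorem map_flood (f : LatticeHom M N) (a b c t : M) (k : ℕ) :
    f (flood a b c k t) = flood (f a) (f b) (f c) k (f t) := by
  simp [flood, map_iterate_spread]

theorem flood_bot [OrderBot M] {a b c : M} (hab : a ⊓ b = ⊥) (hac : a ⊓ c = ⊥)
    (hbc : b ⊓ c = ⊥) (k : ℕ) : flood a b c k ⊥ = ⊥ := by
  have h : spread a b c ⊥ = ⊥ := by
    simp [spread, inf_comm b a, inf_comm c a, hab, hac]
  simp [flood, Function.iterate_fixed h, hbc]

end Terms

/-- The partition into even and odd numbers. -/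
def parity (n : ℕ) : Setoid (Fin n) := Setoid.ker fun x => x.val % 2

/-- The partition into pairs `{2 i, 2 i + 1}`. -/
def evenPairs (n : ℕ) : Setoid (Fin n) := Setoid.ker fun x => x.val / 2

/-- The partition into pairs `{2 i + 1, 2 i + 2}`. -/
def oddPairs (n : ℕ) : Setoid (Fin n) := Setoid.ker fun x => (x.val + 1) / 2

/-- The labelling of the classes of the partition `marks`. -/
def markLabel (q c i : ℕ) : ℕ :=
  if i ≤ 1 then 0
  else if i = 2 * q + 1 ∨ i = 2 * q + 2 then 1
  else if i = 2 * c + 1 ∨ i = 2 * c + 3 ∨ i = 2 * q + 3 then 2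
  else i + 3

/-- The partition with the nontrivial classes `{0, 1}`, `{2 q + 1, 2 q + 2}` and
`{2 c + 1, 2 c + 3, 2 q + 3}`, where numbers not smaller than `n` are ignored. -/
def marks (n q c : ℕ) : Setoid (Fin n) := Setoid.ker fun x => markLabel q c x.val

/-- The numbers from `lo` to `hi`, separated into even and odd ones, and singletons. -/
def strip (n lo hi : ℕ) : Setoid (Fin n) :=
  parity n ⊓ Setoid.block {x | lo ≤ x.val ∧ x.val ≤ hi}

section Relations

variable {n : ℕ} {x y : Fin n}

theorem parity_iff : parity n x y ↔ x.val % 2 = y.val % 2 := Iff.rfl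

theorem evenPairs_iff : evenPairs n x y ↔ x.val / 2 = y.val / 2 := Iff.rfl

theorem oddPairs_iff : oddPairs n x y ↔ (x.val + 1) / 2 = (y.val + 1) / 2 := Iff.rfl

theorem marks_iff {q c : ℕ} : marks n q c x y ↔ markLabel q c x.val = markLabel q c y.val :=
  Iff.rfl

theorem strip_iff {lo hi : ℕ} : strip n lo hi x y ↔ x.val = y.val ∨
    (x.val % 2 = y.val % 2 ∧ lo ≤ x.val ∧ x.val ≤ hi ∧ lo ≤ y.val ∧ y.val ≤ hi) := by
  unfold strip
  rw [Setoid.inf_iff_and]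
  simp only [Setoid.block_iff, parity_iff, Set.mem_ofPred_eq,
    Fin.ext_iff]
  omega

theorem block_pair_iff {a b : Fin n} : Setoid.block {a, b} x y ↔ x.val = y.val ∨
    ((x.val = a.val ∨ x.val = b.val) ∧ (y.val = a.val ∨ y.val = b.val)) := by
  simp only [Setoid.block_iff, Set.mem_insert_iff, Set.mem_singleton_iff, Fin.ext_iff]

theorem strip_le {lo hi : ℕ} {r : Setoid (Fin n)}
    (h : ∀ x y : Fin n, lo ≤ x.val → y.val ≤ hi → y.val = x.val + 2 → r x y) :
    strip n lo hi ≤ r := by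
  have key : ∀ d (x y : Fin n), lo ≤ x.val → y.val ≤ hi → y.val = x.val + 2 * d → r x y := by
    intro d
    induction d with
    | zero =>
      intro x y _ _ hxy
      obtain rfl : x = y := Fin.ext (by omega)
      exact r.refl' x
    | succ d ih =>
      intro x y hx hy hxy
      have hz : x.val + 2 * d < n := by omega
      exact r.trans' (ih x ⟨_, hz⟩ hx (by simp only; omega) rfl)
        (h ⟨_, hz⟩ y (by simp only; omega) hy (by simp only; omega))
  intro x y hxy
  rw [strip_iff] at hxy
  rcases le_total x.val y.val with hle | hle
  · rcases hxy with hxy | hxy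
    · obtain rfl : x = y := Fin.ext hxy
      exact r.refl' x
    · exact key ((y.val - x.val) / 2) x y (by omega) (by omega) (by omega)
  · rcases hxy with hxy | hxy
    · obtain rfl : x = y := Fin.ext hxy
      exact r.refl' x
    · exact r.symm' (key ((x.val - y.val) / 2) y x (by omega) (by omega) (by omega))

theorem parity_inf_evenPairs (n : ℕ) : parity n ⊓ evenPairs n = ⊥ := by
  ext x y
  simp only [Setoid.inf_iff_and, parity_iff, evenPairs_iff, Setoid.bot_def, Fin.ext_iff]
  omega

theorem parity_inf_oddPairs (n : ℕ) : parity n ⊓ oddPairs n = ⊥ := by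
  ext x y
  simp only [Setoid.inf_iff_and, parity_iff, oddPairs_iff, Setoid.bot_def, Fin.ext_iff]
  omega

theorem evenPairs_inf_oddPairs (n : ℕ) : evenPairs n ⊓ oddPairs n = ⊥ := by
  ext x y
  simp only [Setoid.inf_iff_and, evenPairs_iff, oddPairs_iff, Setoid.bot_def, Fin.ext_iff]
  omega

theorem eq_top_of_succ {r : Setoid (Fin n)} (h : ∀ x y : Fin n, y.val = x.val + 1 → r x y) :
    r = ⊤ := by
  have key : ∀ d (x y : Fin n), y.val = x.val + d → r x y := by
    intro d
    induction d with
    | zero =>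
      intro x y hxy
      obtain rfl : x = y := Fin.ext (by omega)
      exact r.refl' x
    | succ d ih =>
      intro x y hxy
      have hz : x.val + d < n := by omega
      exact r.trans' (ih x ⟨_, hz⟩ rfl) (h ⟨_, hz⟩ y (by simp only; omega))
  refine top_le_iff.mp fun x y _ => ?_
  rcases le_total x.val y.val with hle | hle
  · exact key (y.val - x.val) x y (by omega)
  · exact r.symm' (key (x.val - y.val) y x (by omega))

theorem sup_evenPairs_eq_top {r : Setoid (Fin n)} (hn : 3 ≤ n) (h : parity n ≤ r) :
    r ⊔ evenPairs n = ⊤ := by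
  have h01 : (r ⊔ evenPairs n) ⟨0, by omega⟩ ⟨1, by omega⟩ :=
    Setoid.rel_sup_right (evenPairs_iff.mpr (by simp))
  have hp : ∀ x y : Fin n, x.val % 2 = y.val % 2 → (r ⊔ evenPairs n) x y :=
    fun x y hxy => Setoid.rel_sup_left (h hxy)
  refine eq_top_of_succ fun x y hxy => ?_
  rcases Nat.mod_two_eq_zero_or_one x.val with hx | hx
  · exact Setoid.trans' _ (hp _ _ (by simpa using hx))
      (Setoid.trans' _ h01 (hp _ _ (by simp only; omega)))
  · exact Setoid.trans' _ (hp _ _ (by simpa using hx))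
      (Setoid.trans' _ (Setoid.symm' _ h01) (hp _ _ (by simp only; omega)))

theorem sup_oddPairs_eq_top {r : Setoid (Fin n)} (hn : 3 ≤ n) (h : parity n ≤ r) :
    r ⊔ oddPairs n = ⊤ := by
  have h12 : (r ⊔ oddPairs n) ⟨1, by omega⟩ ⟨2, by omega⟩ :=
    Setoid.rel_sup_right (oddPairs_iff.mpr (by simp))
  have hp : ∀ x y : Fin n, x.val % 2 = y.val % 2 → (r ⊔ oddPairs n) x y :=
    fun x y hxy => Setoid.rel_sup_left (h hxy)
  refine eq_top_of_succ fun x y hxy => ?_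
  rcases Nat.mod_two_eq_zero_or_one x.val with hx | hx
  · exact Setoid.trans' _ (hp _ _ (by simpa using hx))
      (Setoid.trans' _ (Setoid.symm' _ h12) (hp _ _ (by simp only; omega)))
  · exact Setoid.trans' _ (hp _ _ (by simpa using hx))
      (Setoid.trans' _ h12 (hp _ _ (by simp only; omega)))

theorem le_spread {r : Setoid (Fin n)} (hr : r ≤ parity n) :
    r ≤ spread (parity n) (evenPairs n) (oddPairs n) r :=
  (le_inf le_sup_left hr).trans le_sup_left

/-- If `r` identifies two numbers at distance two, `spread` identifies their neighbours. -/
theorem spread_rel {r : Setoid (Fin n)} {x y x' y' : Fin n} (hr : r x y)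
    (hxy : y.val = x.val + 2) (hx : x'.val = x.val + 1 ∨ x'.val + 1 = x.val)
    (hxy' : y'.val = x'.val + 2) :
    spread (parity n) (evenPairs n) (oddPairs n) r x' y' := by
  have hpar : parity n x' y' := by rw [parity_iff]; omega
  by_cases he : x.val / 2 = x'.val / 2
  · refine Setoid.rel_sup_left ⟨?_, hpar⟩
    exact Setoid.trans' _ (Setoid.rel_sup_right (evenPairs_iff.mpr he.symm))
      (Setoid.trans' _ (Setoid.rel_sup_left hr)
        (Setoid.rel_sup_right (evenPairs_iff.mpr (by omega))))
  · refine Setoid.rel_sup_right ⟨?_, hpar⟩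
    exact Setoid.trans' _ (Setoid.rel_sup_right (oddPairs_iff.mpr (by omega)))
      (Setoid.trans' _ (Setoid.rel_sup_left hr)
        (Setoid.rel_sup_right (oddPairs_iff.mpr (by omega))))

theorem spread_strip {lo hi : ℕ} (hlo : lo + 2 ≤ hi) (hn : lo + 2 < n) :
    spread (parity n) (evenPairs n) (oddPairs n) (strip n lo hi) =
      strip n (lo - 1) (hi + 1) := by
  apply le_antisymm
  · have he : strip n lo hi ⊔ evenPairs n ≤ Setoid.ker fun x : Fin n =>
        if lo / 2 ≤ x.val / 2 ∧ x.val / 2 ≤ hi / 2 then lo / 2 else x.val / 2 := by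
      refine sup_le (fun x y h => ?_) (fun x y h => ?_)
      · rw [strip_iff] at h
        rw [Setoid.ker_def]
        rcases h with h | h
        · rw [h]
        · rw [if_pos (by omega), if_pos (by omega)]
      · rw [evenPairs_iff] at h
        rw [Setoid.ker_def, h]
    have ho : strip n lo hi ⊔ oddPairs n ≤ Setoid.ker fun x : Fin n =>
        if (lo + 1) / 2 ≤ (x.val + 1) / 2 ∧ (x.val + 1) / 2 ≤ (hi + 1) / 2 then (lo + 1) / 2
        else (x.val + 1) / 2 := by
      refine sup_le (fun x y h => ?_) (fun x y h => ?_)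
      · rw [strip_iff] at h
        rw [Setoid.ker_def]
        rcases h with h | h
        · rw [h]
        · rw [if_pos (by omega), if_pos (by omega)]
      · rw [oddPairs_iff] at h
        rw [Setoid.ker_def, h]
    refine sup_le (fun x y h => ?_) (fun x y h => ?_)
    · have h₁ := Setoid.ker_def.mp (he h.1)
      have h₂ := parity_iff.mp h.2
      rw [strip_iff]
      split_ifs at h₁ <;> omega
    · have h₁ := Setoid.ker_def.mp (ho h.1)
      have h₂ := parity_iff.mp h.2
      rw [strip_iff]
      split_ifs at h₁ <;> omega
  · refine strip_le fun x y hx hy hxy => ?_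
    by_cases h₁ : lo ≤ x.val
    · by_cases h₂ : y.val ≤ hi
      · exact le_spread inf_le_left (strip_iff.mpr (by omega))
      · exact spread_rel (x' := x) (y' := y) (x := ⟨x.val - 1, by omega⟩) (y := ⟨y.val - 1, by omega⟩)
          (strip_iff.mpr (by simp only; omega)) (by simp only; omega) (by simp only; omega) hxy
    · exact spread_rel (x' := x) (y' := y) (x := ⟨x.val + 1, by omega⟩) (y := ⟨y.val + 1, by omega⟩)
        (strip_iff.mpr (by simp only; omega)) (by simp only; omega) (Or.inr rfl) hxy

theorem iterate_spread_strip {lo hi : ℕ} (hlo : lo + 2 ≤ hi) (hn : lo + 2 < n) (k : ℕ) :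
    (spread (parity n) (evenPairs n) (oddPairs n))^[k] (strip n lo hi) =
      strip n (lo - k) (hi + k) := by
  induction k with
  | zero => rfl
  | succ k ih =>
    rw [Function.iterate_succ_apply', ih, spread_strip (by omega) (by omega)]
    rfl

theorem iterate_spread_mono {r s : Setoid (Fin n)} (h : r ≤ s) (k : ℕ) :
    (spread (parity n) (evenPairs n) (oddPairs n))^[k] r ≤
      (spread (parity n) (evenPairs n) (oddPairs n))^[k] s := by
  refine Monotone.iterate (fun t t' ht => ?_) k h
  exact sup_le_sup (inf_le_inf_right _ (sup_le_sup_right ht _))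
    (inf_le_inf_right _ (sup_le_sup_right ht _))

theorem flood_eq_top {r : Setoid (Fin n)} (h : r x y) (hxy : y.val = x.val + 2) {k : ℕ}
    (hk : n ≤ k) : flood (parity n) (evenPairs n) (oddPairs n) k r = ⊤ := by
  have hn : 3 ≤ n := by omega
  have h₁ : strip n x.val y.val ≤ r := strip_le fun x' y' hx hy hxy' => by
    rwa [show x' = x from Fin.ext (by omega), show y' = y from Fin.ext (by omega)]
  have h₂ : parity n ≤ (spread (parity n) (evenPairs n) (oddPairs n))^[k] r := by
    refine le_trans (fun x' y' h' => ?_) (iterate_spread_mono h₁ k)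
    rw [parity_iff] at h'
    rw [iterate_spread_strip (by omega) (by omega), strip_iff]
    omega
  rw [flood, sup_evenPairs_eq_top hn h₂, sup_oddPairs_eq_top hn h₂, inf_top_eq]

end Relations

section Marks

variable {n q c : ℕ}

theorem evenPairs_inf_marks_iff (hq : c + 2 ≤ q) {x y : Fin n} :
    (evenPairs n ⊓ marks n q c) x y ↔ x.val = y.val ∨ (x.val ≤ 1 ∧ y.val ≤ 1) := by
  rw [Setoid.inf_iff_and, evenPairs_iff, marks_iff]
  unfold markLabel
  split_ifs <;> omega

theorem oddPairs_inf_marks_iff (hq : c + 2 ≤ q) {x y : Fin n} :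
    (oddPairs n ⊓ marks n q c) x y ↔ x.val = y.val ∨
      ((x.val = 2 * q + 1 ∨ x.val = 2 * q + 2) ∧ (y.val = 2 * q + 1 ∨ y.val = 2 * q + 2)) := by
  rw [Setoid.inf_iff_and, oddPairs_iff, marks_iff]
  unfold markLabel
  split_ifs <;> first | omega | (rw [and_false, false_iff]; omega)

theorem parity_inf_marks_iff (hc : 1 ≤ c) (hq : c + 2 ≤ q) {x y : Fin n} :
    (parity n ⊓ marks n q c) x y ↔ x.val = y.val ∨
      ((x.val = 2 * c + 1 ∨ x.val = 2 * c + 3 ∨ x.val = 2 * q + 3) ∧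
        (y.val = 2 * c + 1 ∨ y.val = 2 * c + 3 ∨ y.val = 2 * q + 3)) := by
  rw [Setoid.inf_iff_and, parity_iff, marks_iff]
  unfold markLabel
  split_ifs <;> first | omega | (rw [and_false, false_iff]; omega)

theorem fromLeft_eq (hq : c + 2 ≤ q) (hn : 2 * q + 3 ≤ n) (k : ℕ) :
    fromLeft (parity n) (evenPairs n) (oddPairs n) (marks n q c) k = strip n 0 (2 + k) := by
  have h : parity n ⊓ ((evenPairs n ⊓ marks n q c) ⊔ oddPairs n) = strip n 0 2 := by
    apply le_antisymm
    · have hle : (evenPairs n ⊓ marks n q c) ⊔ oddPairs n ≤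
          Setoid.ker fun x : Fin n => max ((x.val + 1) / 2) 1 := by
        refine sup_le (fun x y h => ?_) (fun x y h => ?_)
        · rw [evenPairs_inf_marks_iff hq] at h
          rw [Setoid.ker_def]
          omega
        · rw [oddPairs_iff] at h
          rw [Setoid.ker_def, h]
      intro x y h
      have h₁ := parity_iff.mp h.1
      have h₂ := Setoid.ker_def.mp (hle h.2)
      rw [strip_iff]
      omega
    · refine strip_le fun x y hx hy hxy => ⟨parity_iff.mpr (by omega), ?_⟩
      refine Setoid.trans' _ (y := ⟨1, by omega⟩)
        (Setoid.rel_sup_left ((evenPairs_inf_marks_iff hq).mpr (by simp only; omega)))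
        (Setoid.rel_sup_right (oddPairs_iff.mpr (by simp only; omega)))
  rw [fromLeft, h, iterate_spread_strip (by omega) (by omega), Nat.zero_sub]

theorem fromRight_eq (hq : c + 2 ≤ q) (hn : n = 2 * q + 3 ∨ n = 2 * q + 4) (k : ℕ) :
    fromRight (parity n) (evenPairs n) (oddPairs n) (marks n q c) k =
      strip n (2 * q - k) (2 * q + 3 + k) := by
  have h : parity n ⊓ ((oddPairs n ⊓ marks n q c) ⊔ evenPairs n) =
      strip n (2 * q) (2 * q + 3) := by
    apply le_antisymm
    · have hle : (oddPairs n ⊓ marks n q c) ⊔ evenPairs n ≤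
          Setoid.ker fun x : Fin n => min (x.val / 2) q := by
        refine sup_le (fun x y h => ?_) (fun x y h => ?_)
        · rw [oddPairs_inf_marks_iff hq] at h
          rw [Setoid.ker_def]
          omega
        · rw [evenPairs_iff] at h
          rw [Setoid.ker_def, h]
      intro x y h
      have h₁ := parity_iff.mp h.1
      have h₂ := Setoid.ker_def.mp (hle h.2)
      rw [strip_iff]
      omega
    · refine strip_le fun x y hx hy hxy => ⟨parity_iff.mpr (by omega), ?_⟩
      have hB : ((oddPairs n ⊓ marks n q c) ⊔ evenPairs n) ⟨2 * q + 1, by omega⟩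
          ⟨2 * q + 2, by omega⟩ :=
        Setoid.rel_sup_left ((oddPairs_inf_marks_iff hq).mpr (by simp))
      by_cases h : x.val = 2 * q
      · refine Setoid.trans' _ (Setoid.rel_sup_right (evenPairs_iff.mpr ?_))
          (Setoid.trans' _ hB (Setoid.rel_sup_right (evenPairs_iff.mpr ?_))) <;>
        · simp only
          omega
      · refine Setoid.trans' _ (Setoid.rel_sup_right (evenPairs_iff.mpr ?_))
          (Setoid.trans' _ hB (Setoid.rel_sup_right (evenPairs_iff.mpr ?_))) <;>
        · simp only
          omega
  rw [fromRight, h, iterate_spread_strip (by omega) (by omega)]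

theorem eq_univ_of_mem (hc : 1 ≤ c) (hq : c + 2 ≤ q) (hn : n = 2 * q + 3 ∨ n = 2 * q + 4)
    {T : Set (Setoid (Fin n))} (hT : IsSublattice T) (ha : parity n ∈ T) (hb : evenPairs n ∈ T)
    (hg : oddPairs n ∈ T) (hd : marks n q c ∈ T) : T = Set.univ := by
  have hbot : ⊥ ∈ T := parity_inf_evenPairs n ▸ hT.infClosed ha hb
  have hleft : ∀ k, strip n 0 (2 + k) ∈ T := fun k =>
    fromLeft_eq (n := n) hq (by omega) k ▸ fromLeft_mem hT ha hb hg hd k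
  have hright : ∀ k, strip n (2 * q - k) (2 * q + 3 + k) ∈ T := fun k =>
    fromRight_eq hq hn k ▸ fromRight_mem hT ha hb hg hd k
  have hA : Setoid.block {(⟨0, by omega⟩ : Fin n), ⟨1, by omega⟩} ∈ T := by
    convert hT.infClosed hb hd using 1
    ext x y
    rw [block_pair_iff, evenPairs_inf_marks_iff hq]
    simp only
    omega
  have hB : Setoid.block {(⟨2 * q + 1, by omega⟩ : Fin n), ⟨2 * q + 2, by omega⟩} ∈ T := by
    convert hT.infClosed hg hd using 1
    ext x y
    rw [block_pair_iff, oddPairs_inf_marks_iff hq]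
  have hstep : ∀ i (h : i + 2 < n), i ≤ 2 * q →
      Setoid.block {(⟨i, by omega⟩ : Fin n), ⟨i + 2, h⟩} ∈ T := by
    intro i h hi
    convert hT.infClosed (hleft i) (hright (2 * q - i)) using 1
    ext x y
    rw [block_pair_iff, Setoid.inf_iff_and, strip_iff, strip_iff]
    simp only
    omega
  have hext : ∀ h : 2 * q + 3 < n,
      Setoid.block {(⟨2 * q + 1, by omega⟩ : Fin n), ⟨2 * q + 3, h⟩} ∈ T := by
    intro h
    have hchain : ∀ d (hd : 2 * c + 1 + 2 * d ≤ 2 * q + 1), ∃ s ∈ T,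
        s ⟨2 * c + 1 + 2 * d, by omega⟩ ⟨2 * q + 3, h⟩ ∧
          s ≤ Setoid.block {x : Fin n | x.val % 2 = 1} := by
      intro d
      induction d with
      | zero =>
        intro _
        refine ⟨_, hT.infClosed ha hd, (parity_inf_marks_iff hc hq).mpr (by simp), ?_⟩
        intro x y hxy
        rw [parity_inf_marks_iff hc hq] at hxy
        rw [Setoid.block_iff, Fin.ext_iff]
        simp only [Set.mem_ofPred_eq]
        omega
      | succ d ih =>
        intro hd
        obtain ⟨s, hs, hr, hle⟩ := ih (by omega)
        refine ⟨_, hT.supClosed hs (hstep (2 * c + 1 + 2 * d) (by omega) (by omega)), ?_, ?_⟩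
        · exact Setoid.trans' _ (Setoid.symm' _ (Setoid.rel_sup_right
            (Setoid.block_pair_rel _ _))) (Setoid.rel_sup_left hr)
        · refine sup_le hle (Setoid.block_mono ?_)
          rintro x (rfl | rfl) <;>
          · simp only [Set.mem_ofPred_eq]
            omega
    obtain ⟨s, hs, hr, hle⟩ := hchain (q - c) (by omega)
    have h0 : strip n (2 * q) (2 * q + 3) ∈ T := hright 0
    convert hT.infClosed h0 hs using 1
    apply le_antisymm
    · refine Setoid.block_pair_le ⟨strip_iff.mpr (by simp only; omega), ?_⟩
      convert hr using 2
      omega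
    · rintro x y ⟨h₁, h₂⟩
      have h₁ := strip_iff.mp h₁
      have h₂ := hle h₂
      rw [Setoid.block_iff, Fin.ext_iff] at h₂
      simp only [Set.mem_ofPred_eq] at h₂
      refine block_pair_iff.mpr ?_
      simp only
      omega
  have hstep' : ∀ (x y : Fin n), y.val = x.val + 2 → Setoid.block {x, y} ∈ T := by
    rintro ⟨x, hx⟩ ⟨y, hy⟩ hxy
    simp only at hxy
    subst hxy
    rcases le_or_gt x (2 * q) with h | h
    · exact hstep x hy h
    · obtain rfl : x = 2 * q + 1 := by omega
      exact hext hy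
  have hend : ∀ (x y : Fin n), y.val = x.val + 1 → y.val + 1 = n → Setoid.block {x, y} ∈ T := by
    rintro ⟨x, hx⟩ ⟨y, hy⟩ hxy hyn
    simp only at hxy hyn
    subst hxy
    rcases hn with h | h
    · obtain rfl : x = 2 * q + 1 := by omega
      exact hB
    · obtain rfl : x = 2 * q + 2 := by omega
      convert hT.infClosed hb (hT.supClosed (hext hy) hB) using 1
      apply le_antisymm
      · refine Setoid.block_pair_le ⟨evenPairs_iff.mpr (by simp only; omega), ?_⟩
        exact Setoid.trans' _ (Setoid.symm' _ (Setoid.rel_sup_right (Setoid.block_pair_rel _ _)))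
          (Setoid.rel_sup_left (Setoid.block_pair_rel _ _))
      · rintro x y ⟨h₁, h₂⟩
        have hle : Setoid.block {(⟨2 * q + 1, by omega⟩ : Fin n), ⟨2 * q + 3, hy⟩} ⊔
            Setoid.block {(⟨2 * q + 1, by omega⟩ : Fin n), ⟨2 * q + 2, by omega⟩} ≤
              Setoid.block {x : Fin n | 2 * q + 1 ≤ x.val} := by
          refine sup_le (Setoid.block_mono ?_) (Setoid.block_mono ?_) <;>
          · rintro x (rfl | rfl) <;>
            · simp only [Set.mem_ofPred_eq]
              omega
        have h₁ := evenPairs_iff.mp h₁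
        have h₂ := hle h₂
        rw [Setoid.block_iff, Fin.ext_iff] at h₂
        simp only [Set.mem_ofPred_eq] at h₂
        refine block_pair_iff.mpr ?_
        simp only
        omega
  refine Setoid.eq_univ_of_cycle_mem hT hbot n
    (fun k => if h : 2 * k < n then ⟨2 * k, h⟩ else ⟨2 * n - 1 - 2 * k, by omega⟩)
    (fun x => if x.val % 2 = 0 then x.val / 2 else n - 1 - x.val / 2) ?_ ?_ ?_ ?_ ?_
  · intro x
    split_ifs <;> omega
  · intro x
    apply Fin.ext
    split_ifs <;> simp only <;> omega
  · intro k hk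
    by_cases h : 2 * k < n
    · simp only [dif_pos h]
      rw [if_pos (by omega)]
      omega
    · simp only [dif_neg h]
      rw [if_neg (by omega)]
      omega
  · intro k hk
    by_cases h₁ : 2 * k < n
    · by_cases h₂ : 2 * (k + 1) < n
      · rw [dif_pos h₁, dif_pos h₂]
        exact hstep' _ _ (by simp only; omega)
      · rw [dif_pos h₁, dif_neg h₂]
        rcases hn with h | h
        · rw [Set.pair_comm]
          exact hend _ _ (by simp only; omega) (by simp only; omega)
        · exact hend _ _ (by simp only; omega) (by simp only; omega)
    · rw [dif_neg h₁, dif_neg (by omega), Set.pair_comm]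
      exact hstep' _ _ (by simp only; omega)
  · rw [dif_neg (by omega), dif_pos (by omega), Set.pair_comm]
    convert hA using 4
    exact Fin.ext (by simp only; omega)

theorem flood_left_eq_top (hc : 1 ≤ c) (hq : c + 2 ≤ q) (hn : n = 2 * q + 3 ∨ n = 2 * q + 4)
    {k K : ℕ} (hk : 2 * c + 1 ≤ k) (hK : n ≤ K) :
    flood (parity n) (evenPairs n) (oddPairs n) K (parity n ⊓ marks n q c ⊓
      fromLeft (parity n) (evenPairs n) (oddPairs n) (marks n q c) k) = ⊤ := by
  refine flood_eq_top (x := ⟨2 * c + 1, by omega⟩) (y := ⟨2 * c + 3, by omega⟩)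
    (Setoid.inf_iff_and.mpr ⟨?_, ?_⟩) rfl hK
  · exact (parity_inf_marks_iff hc hq).mpr (by simp)
  · rw [fromLeft_eq hq (by omega)]
    exact strip_iff.mpr (by simp only; omega)

theorem flood_left_eq_bot (hc : 1 ≤ c) (hq : c + 2 ≤ q) (hn : n = 2 * q + 3 ∨ n = 2 * q + 4)
    {k : ℕ} (hk : k < 2 * c + 1) (K : ℕ) :
    flood (parity n) (evenPairs n) (oddPairs n) K (parity n ⊓ marks n q c ⊓
      fromLeft (parity n) (evenPairs n) (oddPairs n) (marks n q c) k) = ⊥ := by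
  have h : parity n ⊓ marks n q c ⊓
      fromLeft (parity n) (evenPairs n) (oddPairs n) (marks n q c) k = ⊥ := by
    rw [fromLeft_eq hq (by omega)]
    refine le_bot_iff.mp fun x y hxy => Fin.ext ?_
    have h₁ := (parity_inf_marks_iff hc hq).mp hxy.1
    have h₂ := strip_iff.mp hxy.2
    omega
  rw [h, flood_bot (parity_inf_evenPairs n) (parity_inf_oddPairs n) (evenPairs_inf_oddPairs n)]

theorem flood_right_eq_top (hc : 1 ≤ c) (hq : c + 2 ≤ q) (hn : n = 2 * q + 3 ∨ n = 2 * q + 4)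
    {k K : ℕ} (hk : 2 * q ≤ k + 2 * c + 1) (hK : n ≤ K) :
    flood (parity n) (evenPairs n) (oddPairs n) K (parity n ⊓ marks n q c ⊓
      fromRight (parity n) (evenPairs n) (oddPairs n) (marks n q c) k) = ⊤ := by
  refine flood_eq_top (x := ⟨2 * c + 1, by omega⟩) (y := ⟨2 * c + 3, by omega⟩)
    (Setoid.inf_iff_and.mpr ⟨?_, ?_⟩) rfl hK
  · exact (parity_inf_marks_iff hc hq).mpr (by simp)
  · rw [fromRight_eq hq hn]
    exact strip_iff.mpr (by simp only; omega)

theorem flood_right_eq_bot (hc : 1 ≤ c) (hq : c + 2 ≤ q) (hn : n = 2 * q + 3 ∨ n = 2 * q + 4)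
    {k : ℕ} (hk : k + 2 * c + 3 < 2 * q) (K : ℕ) :
    flood (parity n) (evenPairs n) (oddPairs n) K (parity n ⊓ marks n q c ⊓
      fromRight (parity n) (evenPairs n) (oddPairs n) (marks n q c) k) = ⊥ := by
  have h : parity n ⊓ marks n q c ⊓
      fromRight (parity n) (evenPairs n) (oddPairs n) (marks n q c) k = ⊥ := by
    rw [fromRight_eq hq hn]
    refine le_bot_iff.mp fun x y hxy => Fin.ext ?_
    have h₁ := (parity_inf_marks_iff hc hq).mp hxy.1
    have h₂ := strip_iff.mp hxy.2
    omega
  rw [h, flood_bot (parity_inf_evenPairs n) (parity_inf_oddPairs n) (evenPairs_inf_oddPairs n)]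

theorem pairwise_ne (hc : 1 ≤ c) (hq : c + 2 ≤ q) (hn : n = 2 * q + 3 ∨ n = 2 * q + 4) :
    parity n ≠ evenPairs n ∧ parity n ≠ oddPairs n ∧ parity n ≠ marks n q c ∧
      evenPairs n ≠ oddPairs n ∧ evenPairs n ≠ marks n q c ∧ oddPairs n ≠ marks n q c := by
  have hrel : ∀ {r s : Setoid (Fin n)} (x y : Fin n), r x y → ¬ s x y → r ≠ s := by
    rintro r s x y hr hs rfl
    exact hs hr
  have h₁ : ¬ marks n q c ⟨0, by omega⟩ ⟨2, by omega⟩ := by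
    rw [marks_iff]
    simp only [markLabel]
    split_ifs <;> first | omega | simp
  have h₂ : ¬ marks n q c ⟨2, by omega⟩ ⟨3, by omega⟩ := by
    rw [marks_iff]
    simp only [markLabel]
    split_ifs <;> omega
  have h₃ : ¬ marks n q c ⟨1, by omega⟩ ⟨2, by omega⟩ := by
    rw [marks_iff]
    simp only [markLabel]
    split_ifs <;> first | omega | simp
  refine ⟨hrel ⟨0, by omega⟩ ⟨2, by omega⟩ ?_ ?_, hrel ⟨0, by omega⟩ ⟨2, by omega⟩ ?_ ?_,
    hrel _ _ ?_ h₁, hrel ⟨0, by omega⟩ ⟨1, by omega⟩ ?_ ?_, hrel _ _ ?_ h₂, hrel _ _ ?_ h₃⟩ <;>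
  simp [parity_iff, evenPairs_iff, oddPairs_iff]

end Marks

end PartConfig

/-- A sublattice of a finite direct product that projects onto each factor and separates any two
factors is the whole product. -/
theorem IsSublattice.eq_univ_of_separating {ι κ : Type*} [Finite ι] [Finite κ] {L : ι → Type*}
    [∀ i, CompleteLattice (L i)] {S : Set (∀ i, κ → L i)} (hS : IsSublattice S) (hbot : ⊥ ∈ S)
    (htop : ⊤ ∈ S) (hsurj : ∀ i j (y : L i), ∃ s ∈ S, s i j = y)
    (hsep : ∀ p r : ι × κ, p ≠ r → ∃ s ∈ S, s p.1 p.2 = ⊤ ∧ s r.1 r.2 = ⊥) : S = Set.univ := by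
  refine Set.eq_univ_of_forall fun x => ?_
  choose e he hetop hebot using hsep
  choose f hf hfx using fun p : ι × κ => hsurj p.1 p.2 (x p.1 p.2)
  let E (p : ι × κ) : ∀ i, κ → L i := ⨅ r : {r // p ≠ r}, e p r.1 r.2
  have hE : ∀ p, E p ∈ S := fun p => hS.infClosed.iInf_mem htop fun r => he p r.1 r.2
  have hEtop : ∀ p, E p p.1 p.2 = ⊤ := by
    intro p
    simp only [E, iInf_apply, iInf_eq_top]
    exact fun r => hetop p r.1 r.2
  have hEbot : ∀ p r, p ≠ r → E p r.1 r.2 = ⊥ := by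
    intro p r h
    exact le_bot_iff.mp ((iInf_le (fun r : {r // p ≠ r} => e p r.1 r.2) ⟨r, h⟩ r.1 r.2).trans_eq
      (hebot p r h))
  have key : x = ⨆ p, f p ⊓ E p := by
    funext i j
    simp only [iSup_apply, Pi.inf_apply]
    apply le_antisymm
    · refine le_iSup_of_le (i, j) ?_
      rw [hfx (i, j), hEtop (i, j), inf_top_eq]
    · refine iSup_le fun p => ?_
      by_cases h : p = (i, j)
      · subst h
        exact inf_le_left.trans_eq (hfx (i, j))
      · rw [hEbot p (i, j) h, inf_bot_eq]
        exact bot_le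
  rw [key]
  exact hS.supClosed.iSup_mem hbot fun p => hS.infClosed (hf p) (hE p)

open PartConfig

/-- For every positive integer `u` there is a natural number `N` such that for every
`n ≥ N` the direct product `Part(n)^u × Part(n+1)^u × … × Part(n+u-1)^u` of `u`-th
direct powers of partition lattices, with componentwise meets and joins, is
four-generated. -/
theorem part_powers_prod_fourGenerated (u : ℕ) (hu : 0 < u) :
    ∃ N : ℕ, ∀ n : ℕ, N ≤ n →
      FourGenerated (∀ i : Fin u, Fin u → Setoid (Fin (n + i.val))) := by
  classical
  refine ⟨2 * (u * u * (u + 2)) + 20, fun n hn => ?_⟩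
  let code (p : Fin u × Fin u) : ℕ := (finProdFinEquiv p).val
  have hcode : ∀ p, (code p + 1) * (u + 2) ≤ u * u * (u + 2) := fun p =>
    Nat.mul_le_mul_right _ (finProdFinEquiv p).isLt
  let q (p : Fin u × Fin u) : ℕ := (n + p.1.val - 3) / 2
  let c (p : Fin u × Fin u) : ℕ := 1 + code p * (u + 2)
  have hc : ∀ p, 1 ≤ c p := fun p => Nat.le_add_right _ _
  have hq : ∀ p, c p + 2 ≤ q p := by
    intro p
    have := hcode p
    rw [add_mul] at this
    simp only [c, q]
    omega
  have hm : ∀ p, n + p.1.val = 2 * q p + 3 ∨ n + p.1.val = 2 * q p + 4 := by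
    intro p
    simp only [q]
    omega
  have hgap : ∀ p r, code p < code r → c p + u + 2 ≤ c r := by
    intro p r h
    have : (code p + 1) * (u + 2) ≤ code r * (u + 2) := Nat.mul_le_mul_right _ h
    rw [add_mul] at this
    simp only [c]
    omega
  have hqdiff : ∀ p r, q p ≤ q r + u := by
    intro p r
    have := p.1.isLt
    simp only [q]
    omega
  let Λ : Type := ∀ i : Fin u, Fin u → Setoid (Fin (n + i.val))
  let a : Λ := fun i _ => parity (n + i.val)
  let b : Λ := fun i _ => evenPairs (n + i.val)
  let g : Λ := fun i _ => oddPairs (n + i.val)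
  let d : Λ := fun i j => marks (n + i.val) (q (i, j)) (c (i, j))
  let X : Finset Λ := {a, b, g, d}
  have hsub := subset_latticeClosure (s := (X : Set Λ))
  have hS : IsSublattice (latticeClosure (X : Set Λ)) := isSublattice_latticeClosure
  have ha : a ∈ latticeClosure (X : Set Λ) := hsub (by simp [X])
  have hb : b ∈ latticeClosure (X : Set Λ) := hsub (by simp [X])
  have hg : g ∈ latticeClosure (X : Set Λ) := hsub (by simp [X])
  have hd : d ∈ latticeClosure (X : Set Λ) := hsub (by simp [X])
  have hleft : ∀ k, flood a b g (n + u) (a ⊓ d ⊓ fromLeft a b g d k) ∈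
      latticeClosure (X : Set Λ) := fun k =>
    flood_mem hS ha hb hg (hS.infClosed (hS.infClosed ha hd) (fromLeft_mem hS ha hb hg hd k)) _
  have hright : ∀ k, flood a b g (n + u) (a ⊓ d ⊓ fromRight a b g d k) ∈
      latticeClosure (X : Set Λ) := fun k =>
    flood_mem hS ha hb hg (hS.infClosed (hS.infClosed ha hd) (fromRight_mem hS ha hb hg hd k)) _
  let φ (p : Fin u × Fin u) :=
    (Pi.evalLatticeHom (α := fun _ : Fin u => Setoid (Fin (n + p.1.val))) p.2).comp
      (Pi.evalLatticeHom (α := fun i : Fin u => Fin u → Setoid (Fin (n + i.val))) p.1)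
  have hφleft : ∀ p k, φ p (flood a b g (n + u) (a ⊓ d ⊓ fromLeft a b g d k)) =
      flood (parity _) (evenPairs _) (oddPairs _) (n + u) (parity _ ⊓ marks _ (q p) (c p) ⊓
        fromLeft (parity _) (evenPairs _) (oddPairs _) (marks _ (q p) (c p)) k) := by
    intro p k
    rw [map_flood, map_inf, map_inf, map_fromLeft]
    rfl
  have hφright : ∀ p k, φ p (flood a b g (n + u) (a ⊓ d ⊓ fromRight a b g d k)) =
      flood (parity _) (evenPairs _) (oddPairs _) (n + u) (parity _ ⊓ marks _ (q p) (c p) ⊓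
        fromRight (parity _) (evenPairs _) (oddPairs _) (marks _ (q p) (c p)) k) := by
    intro p k
    rw [map_flood, map_inf, map_inf, map_fromRight]
    rfl
  refine ⟨X, ?_, ?_⟩
  · obtain ⟨hab, hag, had, hbg, hbd, hgd⟩ :=
      pairwise_ne (hc (⟨0, hu⟩, ⟨0, hu⟩)) (hq _) (hm _)
    have hne : ∀ {x y : Λ}, x ⟨0, hu⟩ ⟨0, hu⟩ ≠ y ⟨0, hu⟩ ⟨0, hu⟩ → x ≠ y := by
      rintro x y h rfl
      exact h rfl
    have hab' : a ≠ b := hne hab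
    have hag' : a ≠ g := hne hag
    have had' : a ≠ d := hne had
    have hbg' : b ≠ g := hne hbg
    have hbd' : b ≠ d := hne hbd
    have hgd' : g ≠ d := hne hgd
    simp only [X]
    rw [Finset.card_insert_of_notMem (by simp [hab', hag', had']),
      Finset.card_insert_of_notMem (by simp [hbg', hbd']), Finset.card_pair hgd']
  · refine hS.eq_univ_of_separating ?_ ?_ ?_ ?_
    · have : a ⊓ b = ⊥ := by
        funext i j
        exact parity_inf_evenPairs _
      exact this ▸ hS.infClosed ha hb
    · have : a ⊔ b = ⊤ := by
        funext i j
        exact sup_evenPairs_eq_top (by omega) le_rfl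
      exact this ▸ hS.supClosed ha hb
    · intro i j y
      have h := eq_univ_of_mem (hc (i, j)) (hq (i, j)) (hm (i, j)) (hS.image (φ (i, j)))
        ⟨a, ha, rfl⟩ ⟨b, hb, rfl⟩ ⟨g, hg, rfl⟩ ⟨d, hd, rfl⟩
      exact Set.eq_univ_iff_forall.mp h y
    · intro p r hpr
      have hne : code p ≠ code r := fun h => hpr (finProdFinEquiv.injective (Fin.ext h))
      have hp := p.1.isLt
      rcases lt_or_gt_of_ne hne with h | h
      · have h' := hgap _ _ h
        refine ⟨_, hleft (2 * c p + 1), ?_, ?_⟩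
        · exact (hφleft p _).trans (flood_left_eq_top (hc p) (hq p) (hm p) le_rfl (by omega))
        · exact (hφleft r _).trans (flood_left_eq_bot (hc r) (hq r) (hm r) (by omega) _)
      · have h' := hgap _ _ h
        have h₁ := hqdiff p r
        have h₂ := hq p
        refine ⟨_, hright (2 * q p - 2 * c p - 1), ?_, ?_⟩
        · exact (hφright p _).trans
            (flood_right_eq_top (hc p) (hq p) (hm p) (by omega) (by omega))
        · exact (hφright r _).trans
            (flood_right_eq_bot (hc r) (hq r) (hm r) (by omega) _)
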